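/- arXiv:2312.14749 — 2 statements merged into one kernel-verified Lean document; each statement's English description precedes it below -/
import Mathlib

section
/- For every i ∈ {0,...,N-1} and every subset H ⊆ {i+1,...,N-1}, the Hamming weight of g_i ⊕ (⊕_{h∈H} g_h) is at least w(g_i). Equivalently, for every nonzero u ∈ F₂^N whose smallest support index is i, w(u·G_N) ≥ 2^{w(i)}. -/
open Matrix

/-- The polar transform `G_N`, the `n`-fold Kronecker power of `[[1,0],[1,1]]` over `F₂`,
indexed MSB-first. -/
def polarG : (n : ℕ) → Matrix (Fin (2 ^ n)) (Fin (2 ^ n)) (ZMod 2)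
  | 0 => 1
  | n + 1 =>
      Matrix.reindex (finProdFinEquiv.trans (finCongr (by ring)))
        (finProdFinEquiv.trans (finCongr (by ring)))
        (Matrix.kroneckerMap (· * ·)
          (!![1, 0; 1, 1] : Matrix (Fin 2) (Fin 2) (ZMod 2)) (polarG n))

/-- Binary Hamming weight of `i`: the number of ones among bits `0,...,n-1`. -/
def bitWeight (n i : ℕ) : ℕ := ((Finset.range n).filter (fun l => i.testBit l)).card

/-- Left-swap rule of the polar partial order. -/
def leftSwap (i j : ℕ) : Prop :=
  ∃ l, i.testBit l = true ∧ i.testBit (l + 1) = false ∧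
    j.testBit l = false ∧ j.testBit (l + 1) = true ∧
    ∀ l', l' ≠ l → l' ≠ l + 1 → i.testBit l' = j.testBit l'

/-- Binary-domination rule of the polar partial order: `i_(l) ≤ j_(l)` for all `l`. -/
def binDom (i j : ℕ) : Prop := ∀ l, i.testBit l = true → j.testBit l = true

/-- The polar partial order: reflexive-transitive closure of the two rules. -/
def polarLE : ℕ → ℕ → Prop :=
  Relation.ReflTransGen (fun i j => leftSwap i j ∨ binDom i j)

/-- The plain polar code with information set `I`. -/
def polarCode (n : ℕ) (I : Finset (Fin (2 ^ n))) : Set (Fin (2 ^ n) → ZMod 2) :=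
  { c | ∃ u : Fin (2 ^ n) → ZMod 2, (∀ j, j ∉ I → u j = 0) ∧ c = u ᵥ* polarG n }

/-- The pre-transformed polar code with rate profile `I` and pre-transform `T`. -/
def ptpc (n : ℕ) (I : Finset (Fin (2 ^ n)))
    (T : Matrix (Fin (2 ^ n)) (Fin (2 ^ n)) (ZMod 2)) : Set (Fin (2 ^ n) → ZMod 2) :=
  { c | ∃ v : Fin (2 ^ n) → ZMod 2, (∀ j, j ∉ I → v j = 0) ∧ c = (v ᵥ* T) ᵥ* polarG n }

/-- `T` is upper triangular: `T i j = 0` whenever `i > j`. -/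
def UpperTri {N : ℕ} (T : Matrix (Fin N) (Fin N) (ZMod 2)) : Prop :=
  ∀ i j : Fin N, j < i → T i j = 0

/-- Minimum distance: the minimum Hamming weight of nonzero codewords. -/
noncomputable def dmin {N : ℕ} (C : Set (Fin N → ZMod 2)) : ℕ :=
  sInf { w | ∃ c ∈ C, c ≠ 0 ∧ hammingNorm c = w }

def polarE (n : ℕ) : Fin 2 × Fin (2 ^ n) ≃ Fin (2 ^ (n + 1)) :=
  finProdFinEquiv.trans (finCongr (by ring))

lemma polarE_val (n : ℕ) (a : Fin 2) (b : Fin (2 ^ n)) :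
    (polarE n (a, b)).val = b.val + 2 ^ n * a.val := by
  simp [polarE]

lemma polarG_succ_apply (n : ℕ) (a c : Fin 2) (b d : Fin (2 ^ n)) :
    polarG (n + 1) (polarE n (a, b)) (polarE n (c, d)) =
      (!![1, 0; 1, 1] : Matrix (Fin 2) (Fin 2) (ZMod 2)) a c * polarG n b d := by
  have h : polarG (n + 1) = Matrix.reindex (polarE n) (polarE n)
        (Matrix.kroneckerMap (· * ·)
          (!![1, 0; 1, 1] : Matrix (Fin 2) (Fin 2) (ZMod 2)) (polarG n)) := rfl
  rw [h]
  simp [Matrix.reindex_apply, Matrix.submatrix_apply]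

lemma vecMul_polarG_succ (n : ℕ) (u : Fin (2 ^ (n + 1)) → ZMod 2) (c : Fin 2) (d : Fin (2 ^ n)) :
    (u ᵥ* polarG (n + 1)) (polarE n (c, d)) =
      (!![1, 0; 1, 1] : Matrix (Fin 2) (Fin 2) (ZMod 2)) 0 c *
        ((fun b => u (polarE n (0, b))) ᵥ* polarG n) d +
      (!![1, 0; 1, 1] : Matrix (Fin 2) (Fin 2) (ZMod 2)) 1 c *
        ((fun b => u (polarE n (1, b))) ᵥ* polarG n) d := by
  simp only [Matrix.vecMul, dotProduct]
  rw [← (polarE n).sum_comp, Fintype.sum_prod_type, Fin.sum_univ_two]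
  simp only [polarG_succ_apply, Finset.mul_sum]
  congr 1 <;> (apply Finset.sum_congr rfl; intros; ring)

lemma hammingNorm_eq_sum {m : ℕ} (x : Fin m → ZMod 2) :
    hammingNorm x = ∑ i, if x i ≠ 0 then 1 else 0 := by
  simp [hammingNorm, Finset.card_filter]

lemma hammingNorm_polarE (n : ℕ) (x : Fin (2 ^ (n + 1)) → ZMod 2) :
    hammingNorm x = hammingNorm (fun b => x (polarE n (0, b))) +
      hammingNorm (fun b => x (polarE n (1, b))) := by
  simp only [hammingNorm_eq_sum]
  rw [← (polarE n).sum_comp, Fintype.sum_prod_type, Fin.sum_univ_two]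

lemma hammingNorm_vecMul_succ (n : ℕ) (u : Fin (2 ^ (n + 1)) → ZMod 2) :
    hammingNorm (u ᵥ* polarG (n + 1)) =
      hammingNorm (((fun b => u (polarE n (0, b))) ᵥ* polarG n) +
        ((fun b => u (polarE n (1, b))) ᵥ* polarG n)) +
      hammingNorm ((fun b => u (polarE n (1, b))) ᵥ* polarG n) := by
  rw [hammingNorm_polarE]
  simp only [vecMul_polarG_succ]
  congr 2 <;> (ext d; simp)

lemma bitWeight_zero_top (n : ℕ) (b : Fin (2 ^ n)) :
    bitWeight (n + 1) (polarE n (0, b)).val = bitWeight n b.val := by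
  rw [polarE_val]
  simp [bitWeight, Finset.range_add_one, Finset.filter_insert, Nat.testBit_lt_two_pow b.isLt]

lemma bitWeight_one_top (n : ℕ) (b : Fin (2 ^ n)) :
    bitWeight (n + 1) (polarE n (1, b)).val = bitWeight n b.val + 1 := by
  rw [polarE_val]
  have h1 : (b.val + 2 ^ n).testBit n = true := by
    rw [add_comm, Nat.testBit_two_pow_add_eq, Nat.testBit_lt_two_pow b.isLt]; rfl
  have h2 : ∀ l ∈ Finset.range n, ((b.val + 2 ^ n).testBit l = true ↔ b.val.testBit l = true) := by
    intro l hl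
    rw [add_comm, Nat.testBit_two_pow_add_gt (Finset.mem_range.mp hl)]
  simp only [bitWeight, Finset.range_add_one, Finset.filter_insert, Fin.val_one, mul_one, h1,
    if_true]
  rw [Finset.card_insert_of_notMem (by simp), Finset.filter_congr h2]

lemma hammingNorm_add_ge {m : ℕ} (x y : Fin m → ZMod 2) :
    hammingNorm x ≤ hammingNorm (x + y) + hammingNorm y := by
  simp only [hammingNorm_eq_sum, ← Finset.sum_add_distrib]
  apply Finset.sum_le_sum
  intro i _
  by_cases hy : y i = 0 <;> by_cases hx : x i = 0 <;> simp [hx, hy]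

lemma weight_lower (n : ℕ) : ∀ (u : Fin (2 ^ n) → ZMod 2) (i : Fin (2 ^ n)), u i ≠ 0 →
    (∀ j, j < i → u j = 0) → 2 ^ bitWeight n i.val ≤ hammingNorm (u ᵥ* polarG n) := by
  induction n with
  | zero =>
    intro u i hi _
    have h : hammingNorm (u ᵥ* polarG 0) ≠ 0 := by
      rw [hammingNorm_ne_zero_iff]
      intro h0
      apply hi
      simpa [polarG] using congrFun h0 i
    have hb : bitWeight 0 i.val = 0 := by simp [bitWeight]
    rw [hb]
    exact Nat.one_le_iff_ne_zero.mpr h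
  | succ n ih =>
    intro u i hi hlt
    obtain ⟨⟨a, b⟩, rfl⟩ := (polarE n).surjective i
    rw [hammingNorm_vecMul_succ]
    have hb := b.isLt
    fin_cases a
    · refine le_trans ?_ (hammingNorm_add_ge _ _)
      refine le_trans (le_of_eq (congrArg _ (bitWeight_zero_top n b))) ?_
      apply ih _ b hi
      intro j hj
      apply hlt
      rw [Fin.lt_def] at hj ⊢
      simp [polarE_val]; exact hj
    · have h0 : (fun b => u (polarE n (0, b))) = 0 := by
        ext c
        apply hlt
        have := c.isLt
        rw [Fin.lt_def]
        simp [polarE_val]; omega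
      have h1 := ih (fun b => u (polarE n (1, b))) b hi (by
        intro j hj
        apply hlt
        rw [Fin.lt_def] at hj ⊢
        simp [polarE_val]; exact hj)
      refine le_trans (le_of_eq (congrArg _ (bitWeight_one_top n b))) ?_
      rw [h0, Matrix.zero_vecMul, zero_add, pow_succ]
      omega

lemma weight_row (n : ℕ) : ∀ i : Fin (2 ^ n),
    hammingNorm (polarG n i) = 2 ^ bitWeight n i.val := by
  induction n with
  | zero =>
    intro i
    fin_cases i
    simp [polarG, bitWeight, hammingNorm_eq_sum]
    decide
  | succ n ih =>
    intro i
    obtain ⟨⟨a, b⟩, rfl⟩ := (polarE n).surjective i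
    rw [hammingNorm_polarE]
    simp only [polarG_succ_apply]
    fin_cases a
    · refine Eq.trans ?_ (congrArg _ (bitWeight_zero_top n b)).symm
      rw [← ih b]
      simp [hammingNorm_eq_sum]
    · refine Eq.trans ?_ (congrArg _ (bitWeight_one_top n b)).symm
      rw [pow_succ, ← ih b]
      simp [hammingNorm_eq_sum, mul_two]

/-- Adding to `g_i` any sum of rows with larger indices cannot decrease the
Hamming weight below `w(g_i)`; equivalently, every nonzero `u` with smallest support
index `i` satisfies `w(u·G_N) ≥ 2^{w(i)}`. -/
theorem stmt3 (n : ℕ) :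
    (∀ i : Fin (2 ^ n), ∀ H : Finset (Fin (2 ^ n)), (∀ h ∈ H, i < h) →
      hammingNorm (polarG n i + ∑ h ∈ H, polarG n h) ≥ hammingNorm (polarG n i)) ∧
    (∀ u : Fin (2 ^ n) → ZMod 2, u ≠ 0 → ∀ i : Fin (2 ^ n),
      IsLeast {j | u j ≠ 0} i → hammingNorm (u ᵥ* polarG n) ≥ 2 ^ bitWeight n i.val) := by
  refine ⟨?_, ?_⟩
  · intro i H hH
    have key : polarG n i + ∑ h ∈ H, polarG n h =
        (Pi.single i 1 + ∑ h ∈ H, Pi.single h 1 : Fin (2 ^ n) → ZMod 2) ᵥ* polarG n := by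
      rw [Matrix.add_vecMul, Matrix.sum_vecMul]
      simp only [Matrix.single_one_vecMul]
      rfl
    rw [weight_row, key]
    apply weight_lower
    · have : (∑ h ∈ H, Pi.single h 1 : Fin (2 ^ n) → ZMod 2) i = 0 := by
        rw [Finset.sum_apply]
        apply Finset.sum_eq_zero
        intro h hh
        exact Pi.single_eq_of_ne (hH h hh).ne _
      simp only [Pi.add_apply, this]
      simp
    · intro j hj
      rw [Pi.add_apply, Finset.sum_apply, Pi.single_eq_of_ne hj.ne, zero_add]
      apply Finset.sum_eq_zero
      intro h hh
      exact Pi.single_eq_of_ne (hj.trans (hH h hh)).ne _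
  · intro u _ i hi
    apply weight_lower n u i hi.1
    intro j hj
    by_contra h
    exact absurd (hi.2 h) (not_le.mpr hj)
end

section
/- For 0 ≤ r ≤ n, the upward closure of the singleton {2^{n−r}−1} under the polar partial order equals {j ∈ {0,...,2^n−1} : w(j) ≥ n−r}. Consequently, the plain polar code with information set {j : w(j) ≥ n−r} (the Reed–Muller code RM(r,n)) has minimum distance 2^{n−r}. -/
open Matrix

lemma swap_bw {n i j : ℕ} (hj : j < 2 ^ n) (h : leftSwap i j) :
    bitWeight n i = bitWeight n j := by
  obtain ⟨l, h1, h2, h3, h4, h5⟩ := h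
  have hl : l + 1 < n := by
    by_contra hc
    have := Nat.testBit_lt_two_pow (lt_of_lt_of_le hj (Nat.pow_le_pow_right (by norm_num) (not_lt.mp hc)))
    simp_all
  unfold bitWeight
  apply Finset.card_equiv (Equiv.swap l (l + 1))
  intro m
  simp only [Finset.mem_filter, Finset.mem_range]
  by_cases hm : m = l
  · subst hm; simp [h1, h4, hl]; omega
  by_cases hm' : m = l + 1
  · subst hm'; simp [h2, h3]
  · rw [Equiv.swap_apply_of_ne_of_ne hm hm', h5 m hm hm']

lemma step_lt {n i j : ℕ} (hj : j < 2 ^ n) (h : leftSwap i j ∨ binDom i j) : i < 2 ^ n := by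
  have hb : ∀ m, n ≤ m → j.testBit m = false := fun m hm =>
    Nat.testBit_lt_two_pow (lt_of_lt_of_le hj (Nat.pow_le_pow_right (by norm_num) hm))
  apply Nat.lt_pow_two_of_testBit
  intro m hm
  rcases h with ⟨l, h1, h2, h3, h4, h5⟩ | h
  · have hl : l + 1 < n := by
      by_contra hc
      have := hb (l + 1) (not_lt.mp hc)
      simp_all
    rw [h5 m (by omega) (by omega)]; exact hb m hm
  · by_contra hc
    have := h m (by simpa using hc)
    rw [hb m hm] at this
    simp at this

lemma step_bw {n i j : ℕ} (hj : j < 2 ^ n) (h : leftSwap i j ∨ binDom i j) :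
    bitWeight n i ≤ bitWeight n j := by
  rcases h with h | h
  · exact (swap_bw hj h).le
  · apply Finset.card_le_card
    intro m
    simp only [Finset.mem_filter, Finset.mem_range]
    exact fun ⟨a, b⟩ => ⟨a, h m b⟩

lemma bw_ones {n k m : ℕ} (hk : k ≤ n) (hm : ∀ l, m.testBit l = true ↔ l < k) :
    bitWeight n m = k := by
  unfold bitWeight
  have : (Finset.range n).filter (fun l => m.testBit l) = Finset.range k := by
    ext l; simp only [Finset.mem_filter, Finset.mem_range, hm]; omega
  rw [this, Finset.card_range]

lemma bw_base {n k : ℕ} (hk : k ≤ n) : bitWeight n (2 ^ k - 1) = k :=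
  bw_ones hk (by intro l; simp [Nat.testBit_two_pow_sub_one])

lemma le_bw {n a j : ℕ} (h : polarLE a j) (hj : j < 2 ^ n) : bitWeight n a ≤ bitWeight n j := by
  induction h with
  | refl => exact le_rfl
  | tail _ h2 ih => exact (ih (step_lt hj h2)).trans (step_bw hj h2)

lemma bw_le {n k : ℕ} : ∀ j : ℕ, j < 2 ^ n → k ≤ bitWeight n j → polarLE (2 ^ k - 1) j := by
  intro j
  induction j using Nat.strong_induction_on with
  | _ j ih =>
  intro hj hk
  by_cases hs : ∃ l, j.testBit l = false ∧ j.testBit (l + 1) = true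
  · obtain ⟨l, h0, h1⟩ := hs
    have hi : ∀ m, (j ^^^ (2 ^ l ^^^ 2 ^ (l + 1))).testBit m =
        (j.testBit m ^^ (decide (l = m) ^^ decide (l + 1 = m))) := by
      intro m; simp [Nat.testBit_xor, Nat.testBit_two_pow]
    set i := j ^^^ (2 ^ l ^^^ 2 ^ (l + 1)) with hidef
    have hsw : leftSwap i j := by
      refine ⟨l, ?_, ?_, h0, h1, ?_⟩
      · rw [hi]; simp [h0]
      · rw [hi]; simp [h1]
      · intro m hm hm'; rw [hi]; simp [Ne.symm hm, Ne.symm hm']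
    have hlt : i < j := by
      apply Nat.lt_of_testBit (l + 1)
      · rw [hi]; simp [h1]
      · exact h1
      · intro m hm; rw [hi]
        have a1 : l ≠ m := by omega
        have a2 : l + 1 ≠ m := by omega
        simp [a1, a2]
    refine Relation.ReflTransGen.tail (ih i hlt (hlt.trans hj) ?_) (Or.inl hsw)
    rw [swap_bw hj hsw]; exact hk
  · push Not at hs
    have hdown : ∀ m l, l ≤ m → j.testBit m = true → j.testBit l = true := by
      intro m l hlm hm
      induction m with
      | zero => have : l = 0 := by omega
                subst this; exact hm
      | succ m ihm =>
        rcases Nat.lt_or_ge m l with h | h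
        · have : l = m + 1 := by omega
          rw [this]; exact hm
        · apply ihm h
          by_contra hc
          exact hs m (by simpa using hc) hm
    apply Relation.ReflTransGen.single
    right
    intro l hl
    have hlk : l < k := by simpa [Nat.testBit_two_pow_sub_one] using hl
    by_contra hc
    have : bitWeight n j ≤ l := by
      unfold bitWeight
      calc _ ≤ (Finset.range l).card := by
            apply Finset.card_le_card
            intro m hm
            simp only [Finset.mem_filter, Finset.mem_range] at hm ⊢
            by_contra hml
            exact hc (hdown m l (not_lt.mp hml) hm.2)
        _ = l := Finset.card_range l
    omega

/-- index splitting -/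
def pe (n : ℕ) : Fin 2 × Fin (2 ^ n) ≃ Fin (2 ^ (n + 1)) :=
  finProdFinEquiv.trans (finCongr (by ring))

lemma pe_val (n : ℕ) (x : Fin 2) (j : Fin (2 ^ n)) : (pe n (x, j)).val = j.val + 2 ^ n * x.val := by
  simp [pe]

lemma bw_pe (n : ℕ) (x : Fin 2) (j : Fin (2 ^ n)) :
    bitWeight (n + 1) (pe n (x, j)).val = bitWeight n j.val + x.val := by
  rw [pe_val]
  unfold bitWeight
  rw [Finset.range_add_one, Finset.filter_insert]
  have h1 : (j.val + 2 ^ n * x.val).testBit n = decide (x = 1) := by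
    have hj := Nat.testBit_lt_two_pow j.2
    fin_cases x
    · simpa using hj
    · simp [Nat.add_comm j.val, Nat.testBit_two_pow_add_eq, hj]
  have h2 : (Finset.range n).filter (fun l => (j.val + 2 ^ n * x.val).testBit l) =
      (Finset.range n).filter (fun l => j.val.testBit l) := by
    apply Finset.filter_congr
    intro l hl
    rw [Finset.mem_range] at hl
    fin_cases x
    · simp
    · simp [Nat.add_comm j.val, Nat.testBit_two_pow_add_gt hl]
  rw [h1, h2]
  fin_cases x <;> simp

lemma vm (n : ℕ) (u : Fin (2 ^ (n + 1)) → ZMod 2) (x : Fin 2) (j : Fin (2 ^ n)) :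
    (u ᵥ* polarG (n + 1)) (pe n (x, j)) =
      ((if x = 0 then (fun i => u (pe n (0, i))) + (fun i => u (pe n (1, i)))
        else (fun i => u (pe n (1, i)))) ᵥ* polarG n) j := by
  have hG : ∀ y i, polarG (n + 1) (pe n (y, i)) (pe n (x, j)) =
      (!![1, 0; 1, 1] : Matrix (Fin 2) (Fin 2) (ZMod 2)) y x * polarG n i j := by
    intro y i
    change Matrix.reindex (pe n) (pe n) _ _ _ = _
    simp
  simp only [Matrix.vecMul, dotProduct]
  rw [← (pe n).sum_comp, Fintype.sum_prod_type, Fin.sum_univ_two]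
  simp only [hG]
  fin_cases x
  · simp [add_mul, Finset.sum_add_distrib]
  · simp

lemma hn (n : ℕ) (u : Fin (2 ^ (n + 1)) → ZMod 2) :
    hammingNorm (u ᵥ* polarG (n + 1)) =
      hammingNorm (((fun i => u (pe n (0, i))) + (fun i => u (pe n (1, i)))) ᵥ* polarG n) +
      hammingNorm ((fun i => u (pe n (1, i))) ᵥ* polarG n) := by
  simp only [hammingNorm, Finset.card_filter]
  rw [← (pe n).sum_comp, Fintype.sum_prod_type, Fin.sum_univ_two]
  simp only [vm]
  simp

lemma lower : ∀ (n k : ℕ) (u : Fin (2 ^ n) → ZMod 2),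
    (∀ j, bitWeight n j.val < k → u j = 0) → u ᵥ* polarG n ≠ 0 →
    2 ^ k ≤ hammingNorm (u ᵥ* polarG n) := by
  intro n
  induction n with
  | zero =>
    intro k u hu h0
    rcases Nat.eq_zero_or_pos k with rfl | hk
    · have := hammingNorm_pos_iff.mpr h0
      exact this
    · exfalso; apply h0
      have : u = 0 := by funext j; exact hu j (by simpa [bitWeight] using hk)
      rw [this, Matrix.zero_vecMul]
  | succ n ih =>
    intro k u hu h0
    rcases k with _ | k
    · have := hammingNorm_pos_iff.mpr h0
      rw [pow_zero]; exact this
    have hpos := hammingNorm_pos_iff.mpr h0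
    rw [hn] at hpos ⊢
    set a : Fin (2 ^ n) → ZMod 2 := fun i => u (pe n (0, i)) with ha
    set b : Fin (2 ^ n) → ZMod 2 := fun i => u (pe n (1, i)) with hb
    have ha' : ∀ j, bitWeight n j.val < k + 1 → a j = 0 := fun j hj =>
      hu _ (by rw [bw_pe]; simpa using hj)
    have hb' : ∀ j, bitWeight n j.val < k → b j = 0 := fun j hj =>
      hu _ (by rw [bw_pe]; simpa using hj)
    by_cases hbz : b ᵥ* polarG n = 0
    · rw [Matrix.add_vecMul, hbz] at hpos ⊢
      simp only [add_zero, hammingNorm_zero] at hpos ⊢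
      exact ih (k + 1) a ha' (hammingNorm_pos_iff.mp hpos)
    by_cases hab : (a + b) ᵥ* polarG n = 0
    · have hEq : a ᵥ* polarG n = b ᵥ* polarG n := by
        rw [Matrix.add_vecMul] at hab
        funext i
        have := congrFun hab i
        simp only [Pi.add_apply, Pi.zero_apply] at this
        exact CharTwo.add_eq_zero.mp this
      rw [hab, ← hEq]
      have := ih (k + 1) a ha' (by rw [hEq]; exact hbz)
      omega
    · have h1 := ih k b hb' hbz
      have h2 := ih k (a + b) (fun j hj => by
        rw [Pi.add_apply, ha' j (by omega), hb' j hj, add_zero]) hab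
      rw [pow_succ]; omega

lemma attain : ∀ (n : ℕ) (i : Fin (2 ^ n)),
    hammingNorm (Pi.single i (1 : ZMod 2) ᵥ* polarG n) = 2 ^ bitWeight n i.val := by
  intro n
  induction n with
  | zero =>
    intro i
    have : i = 0 := by
      apply Fin.ext
      have := i.2
      simp at this ⊢
    subst this
    simp [polarG, bitWeight, hammingNorm]
    rw [Finset.filter_singleton]
    simp
  | succ n ih =>
    intro i
    obtain ⟨⟨x, j⟩, rfl⟩ := (pe n).surjective i
    rw [hn, bw_pe]
    have hs : ∀ y, (fun i => (Pi.single (pe n (x, j)) (1 : ZMod 2) : Fin (2 ^ (n + 1)) → ZMod 2)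
        (pe n (y, i))) = if y = x then Pi.single j 1 else 0 := by
      intro y
      funext i
      by_cases h : y = x <;> by_cases h' : i = j <;> simp [Pi.single_apply, h, h']
    rw [hs, hs]
    fin_cases x
    · simpa using ih j
    · have := ih j
      simp only [Fin.mk_one, Fin.isValue, zero_ne_one, if_false, if_true, zero_add, this]
      simp [pow_succ]; omega

/-- For `r ≤ n`, the upward closure of `{2^{n−r}−1}` in the polar order
is `{j < 2^n : w(j) ≥ n−r}`; the polar code with this information set (the Reed–Muller
code `RM(r,n)`) has minimum distance `2^{n−r}`. -/
theorem stmt11 (n r : ℕ) (hr : r ≤ n) :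
    ({j : ℕ | j < 2 ^ n ∧ polarLE (2 ^ (n - r) - 1) j} =
      {j : ℕ | j < 2 ^ n ∧ n - r ≤ bitWeight n j}) ∧
    dmin (polarCode n
      (Finset.univ.filter (fun j : Fin (2 ^ n) => n - r ≤ bitWeight n j.val))) =
      2 ^ (n - r) := by
  have hk : n - r ≤ n := Nat.sub_le _ _
  generalize n - r = k at hk
  constructor
  · ext j
    simp only [Set.mem_setOf_eq]
    constructor
    · rintro ⟨hj, h⟩
      refine ⟨hj, ?_⟩
      have := le_bw h hj
      rwa [bw_base hk] at this
    · rintro ⟨hj, h⟩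
      exact ⟨hj, bw_le j hj h⟩
  · unfold dmin
    apply IsLeast.csInf_eq
    constructor
    · have hlt : 2 ^ k - 1 < 2 ^ n := by
        have := Nat.pow_le_pow_right (n := 2) (by norm_num) hk
        have := Nat.two_pow_pos k
        omega
      have hw := attain n ⟨2 ^ k - 1, hlt⟩
      simp only [bw_base hk] at hw
      refine ⟨_, ⟨Pi.single ⟨2 ^ k - 1, hlt⟩ 1, ?_, rfl⟩, ?_, hw⟩
      · intro j hj
        apply Pi.single_eq_of_ne
        rintro rfl
        simp [bw_base hk] at hj
      · apply hammingNorm_pos_iff.mp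
        rw [hw]; positivity
    · rintro w ⟨c, ⟨u, hu, rfl⟩, h0, rfl⟩
      apply lower n k u _ h0
      intro j hj
      apply hu
      simpa using hj
end
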